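/- arXiv:2209.15300 — 2 statements merged into one kernel-verified Lean document; each statement's English description precedes it below -/
import Mathlib

section
/- Let b > 1 and c > 0 be real constants and suppose that s and t admit a b-expansion overlap of size at least c·log_b(m). Then there exists an exploration step k ∈ {1,...,d(s,t)} such that the meeting cost satisfies M(k) = c_s([1,k]) + c_t([k+1,d(s,t)]) ≤ 8·(b²/(b−1))·m^{1−c/2}. -/
open Finset

section Defs

variable {V : Type*} [Fintype V]

/-- The degree of vertex `u` in `G`. -/
noncomputable def deg (G : SimpleGraph V) (u : V) : ℕ := Nat.card (G.neighborSet u)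

/-- The number `m` of edges of `G`. -/
noncomputable def edgeCount (G : SimpleGraph V) : ℕ := Nat.card G.edgeSet

/-- The BFS layer `ℓ(v, i)`: vertices at distance exactly `i` from `v`. -/
noncomputable def layer (G : SimpleGraph V) (v : V) (i : ℕ) : Finset V :=
  Finset.univ.filter fun u => G.dist v u = i

/-- Exploration cost `c_s(i)` of exploration step `i` from `s`. -/
noncomputable def costS (G : SimpleGraph V) (s : V) (i : ℕ) : ℕ :=
  ∑ u ∈ layer G s (i - 1), deg G u

/-- Exploration cost `c_t(i)` of exploration step `i` from `t`
(for the start--destination pair `(s, t)`). -/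
noncomputable def costT (G : SimpleGraph V) (s t : V) (i : ℕ) : ℕ :=
  ∑ u ∈ layer G t (G.dist s t - i), deg G u

/-- Cost `c_s([i, j])` of the sequence of exploration steps `[i, j]` from `s`. -/
noncomputable def costSseq (G : SimpleGraph V) (s : V) (i j : ℕ) : ℕ :=
  ∑ k ∈ Finset.Icc i j, costS G s k

/-- Cost `c_t([i, j])` of the sequence of exploration steps `[i, j]` from `t`. -/
noncomputable def costTseq (G : SimpleGraph V) (s t : V) (i j : ℕ) : ℕ :=
  ∑ k ∈ Finset.Icc i j, costT G s t k

/-- The sequence of exploration steps `[i, j]` is `b`-expanding from `s`: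
`c_s(k+1) ≥ b · c_s(k)` for every `k ∈ [i, j)`. -/
def ExpandS (G : SimpleGraph V) (s : V) (b : ℝ) (i j : ℕ) : Prop :=
  ∀ k, i ≤ k → k < j → b * (costS G s k : ℝ) ≤ (costS G s (k + 1) : ℝ)

/-- The sequence of exploration steps `[i, j]` is `b`-expanding from `t`:
`c_t(k-1) ≥ b · c_t(k)` for every `k ∈ (i, j]`. -/
def ExpandT (G : SimpleGraph V) (s t : V) (b : ℝ) (i j : ℕ) : Prop :=
  ∀ k, i < k → k ≤ j → b * (costT G s t k : ℝ) ≤ (costT G s t (k - 1) : ℝ)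

/-- `e = expan_s(b)`: the latest step such that `[1, e]` is `b`-expanding from `s`. -/
def IsExpanS (G : SimpleGraph V) (s t : V) (b : ℝ) (e : ℕ) : Prop :=
  1 ≤ e ∧ e ≤ G.dist s t ∧ ExpandS G s b 1 e ∧
    ∀ e', e < e' → e' ≤ G.dist s t → ¬ ExpandS G s b 1 e'

/-- `e = expan_t(b)`: the smallest step such that `[e, d(s,t)]` is `b`-expanding from `t`. -/
def IsExpanT (G : SimpleGraph V) (s t : V) (b : ℝ) (e : ℕ) : Prop :=
  1 ≤ e ∧ e ≤ G.dist s t ∧ ExpandT G s t b e (G.dist s t) ∧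
    ∀ e', 1 ≤ e' → e' < e → ¬ ExpandT G s t b e' (G.dist s t)

/-- `cs = cheap_s(α)`: the latest step with `c_s([1, cs]) ≤ m^α`. -/
def IsCheapS (G : SimpleGraph V) (s t : V) (α : ℝ) (cs : ℕ) : Prop :=
  1 ≤ cs ∧ cs ≤ G.dist s t ∧
    (costSseq G s 1 cs : ℝ) ≤ (edgeCount G : ℝ) ^ α ∧
    ∀ j, cs < j → j ≤ G.dist s t →
      ¬ ((costSseq G s 1 j : ℝ) ≤ (edgeCount G : ℝ) ^ α)

/-- `ct = cheap_t(α)`: the smallest step with `c_t([ct, d(s,t)]) ≤ m^α`. -/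
def IsCheapT (G : SimpleGraph V) (s t : V) (α : ℝ) (ct : ℕ) : Prop :=
  1 ≤ ct ∧ ct ≤ G.dist s t ∧
    (costTseq G s t ct (G.dist s t) : ℝ) ≤ (edgeCount G : ℝ) ^ α ∧
    ∀ j, 1 ≤ j → j < ct →
      ¬ ((costTseq G s t j (G.dist s t) : ℝ) ≤ (edgeCount G : ℝ) ^ α)

/-- `B` bounds the expansion in every applicable exploration step between `s` and `t`:
no sequence of exploration steps is more than `B`-expanding from `s` or from `t`. -/
def ExpBound (G : SimpleGraph V) (s t : V) (B : ℝ) : Prop :=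
  (∀ k, 1 ≤ k → k + 1 ≤ G.dist s t → (costS G s (k + 1) : ℝ) ≤ B * (costS G s k : ℝ)) ∧
  (∀ k, 2 ≤ k → k ≤ G.dist s t → (costT G s t (k - 1) : ℝ) ≤ B * (costT G s t k : ℝ))

/-- `B` is the highest expansion between `s` and `t`: the smallest number such that
no sequence of exploration steps is more than `B`-expanding from `s` or from `t`. -/
def IsHighestExpansion (G : SimpleGraph V) (s t : V) (B : ℝ) : Prop :=
  ExpBound G s t B ∧ ∀ B', ExpBound G s t B' → B ≤ B'

/-- Meeting cost `M(k) = c_s([1, k]) + c_t([k+1, d(s,t)])` of the bidirectional BFS whose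
forward search performs `k` exploration steps and whose backward search performs the rest. -/
noncomputable def meetCost (G : SimpleGraph V) (s t : V) (k : ℕ) : ℕ :=
  costSseq G s 1 k + costTseq G s t (k + 1) (G.dist s t)

/-- `ρ = max{S₂, T₂} / min{S₁, T₁}` where `S₁ = expan_s`, `S₂ = cheap_t − expan_s − 1`,
`T₁ = d(s,t) − expan_t + 1`, `T₂ = expan_t − cheap_s − 1`, computed from
`d = d(s,t)`, `cs = cheap_s`, `ct = cheap_t`, `es = expan_s`, `et = expan_t`. -/
noncomputable def rho (d cs ct es et : ℕ) : ℝ :=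
  max ((ct : ℝ) - es - 1) ((et : ℝ) - cs - 1) / min (es : ℝ) ((d : ℝ) - et + 1)

end Defs

theorem sum_deg_eq_two_mul_edgeCount {V : Type*} [Fintype V] (G : SimpleGraph V) :
    ∑ u, deg G u = 2 * edgeCount G := by
  classical
  simp only [deg, edgeCount, Nat.card_eq_fintype_card, SimpleGraph.card_neighborSet_eq_degree,
    ← SimpleGraph.edgeFinset_card]
  exact G.sum_degrees_eq_twice_card_edges

theorem costS_le_two_mul_edgeCount {V : Type*} [Fintype V] (G : SimpleGraph V) (s : V) (i : ℕ) :
    costS G s i ≤ 2 * edgeCount G :=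
  sum_deg_eq_two_mul_edgeCount G ▸
    sum_le_sum_of_subset_of_nonneg (subset_univ _) fun _ _ _ => Nat.zero_le _

theorem edgeCount_pos {V : Type*} [Fintype V] {G : SimpleGraph V} (hconn : G.Connected)
    {s t : V} (hst : s ≠ t) : 0 < edgeCount G := by
  have : Nontrivial V := ⟨s, t, hst⟩
  obtain ⟨w, hw⟩ := hconn.preconnected.exists_adj_of_nontrivial s
  have : Nonempty G.edgeSet := ⟨⟨s(s, w), hw⟩⟩
  exact Nat.card_pos

theorem costT_eq_costS {V : Type*} [Fintype V] (G : SimpleGraph V) (s t : V) (i : ℕ) :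
    costT G s t i = costS G t (G.dist s t - i + 1) := rfl

theorem costTseq_eq_costSseq {V : Type*} [Fintype V] (G : SimpleGraph V) (s t : V) {k : ℕ} :
    costTseq G s t (k + 1) (G.dist s t) = costSseq G t 1 (G.dist s t - k) := by
  unfold costTseq costSseq
  refine sum_nbij' (fun i => G.dist s t - i + 1) (fun i => G.dist s t - i + 1) ?_ ?_ ?_ ?_
    fun _ _ => costT_eq_costS ..
  all_goals simp only [mem_Icc]; omega

theorem ExpandT.expandS {V : Type*} [Fintype V] {G : SimpleGraph V} {s t : V} {b : ℝ} {e : ℕ}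
    (h : ExpandT G s t b e (G.dist s t)) : ExpandS G t b 1 (G.dist s t - e + 1) := by
  intro k hk hke
  have h' := h (G.dist s t - k + 1) (by omega) (by omega)
  rw [costT_eq_costS, costT_eq_costS] at h'
  convert h' using 4 <;> omega

/-- A sequence growing by a factor of at least `b` in each step has geometrically bounded
partial sums. -/
theorem sum_Icc_mul_pow_le_of_expanding {b : ℝ} (hb : 1 < b) {f : ℕ → ℝ} (hf : ∀ i, 0 ≤ f i)
    {n k : ℕ} (hexp : ∀ i, 1 ≤ i → i < n + 1 → b * f i ≤ f (i + 1)) (hk : k ≤ n + 1) :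
    (b - 1) * (∑ i ∈ Icc 1 k, f i) * b ^ (n + 1 - k) ≤ b * f (n + 1) := by
  have hb0 : 0 < b := by linarith
  induction n generalizing k with
  | zero =>
    interval_cases k
    · simpa using mul_nonneg hb0.le (hf 1)
    · simpa using mul_le_mul_of_nonneg_right (sub_le_self b zero_le_one) (hf 1)
  | succ n ih =>
    have hstep := hexp (n + 1) (by omega) (by omega)
    have hprefix : ∀ j ≤ n + 1,
        (b - 1) * (∑ i ∈ Icc 1 j, f i) * b ^ (n + 1 - j) ≤ f (n + 1 + 1) := fun j hj =>
      (ih (fun i hi hin => hexp i hi (by omega)) hj).trans hstep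
    rcases Nat.le_succ_iff.mp hk with hk' | rfl
    · rw [Nat.succ_sub hk', pow_succ', mul_left_comm]
      exact mul_le_mul_of_nonneg_left (hprefix k hk') hb0.le
    · have hlast := hprefix (n + 1) le_rfl
      rw [Nat.sub_self, pow_zero, mul_one] at hlast ⊢
      rw [sum_Icc_succ_top (by omega)]
      linarith

theorem costSseq_mul_pow_le {V : Type*} [Fintype V] {G : SimpleGraph V} {s : V} {b : ℝ}
    (hb : 1 < b) {e k : ℕ} (he : 1 ≤ e) (hexp : ExpandS G s b 1 e) (hk : k ≤ e) :
    (b - 1) * costSseq G s 1 k * b ^ (e - k) ≤ 2 * b * edgeCount G := by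
  obtain ⟨n, rfl⟩ := Nat.exists_eq_add_of_le' he
  have h := sum_Icc_mul_pow_le_of_expanding hb (f := fun i => (costS G s i : ℝ))
    (fun _ => Nat.cast_nonneg _) hexp hk
  have hm : (costS G s (n + 1) : ℝ) ≤ 2 * edgeCount G := by
    exact_mod_cast costS_le_two_mul_edgeCount G s (n + 1)
  simp only [costSseq, Nat.cast_sum]
  nlinarith

theorem rpow_div_two_le_mul_pow {b c m L : ℝ} (hb : 1 < b) (hm : 0 < m)
    (hL : c * Real.logb b m ≤ L) {n : ℕ} (hn : L ≤ 2 * n + 2) :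
    m ^ (c / 2) ≤ b * b ^ n := by
  have hb0 : 0 < b := by linarith
  calc m ^ (c / 2) = b ^ (Real.logb b m * (c / 2)) := by
        rw [Real.rpow_mul hb0.le, Real.rpow_logb hb0 hb.ne' hm]
    _ ≤ b ^ ((n + 1 : ℕ) : ℝ) := by
        apply Real.rpow_le_rpow_of_exponent_le hb.le
        push_cast
        linarith
    _ = b * b ^ n := by rw [Real.rpow_natCast, pow_succ']

theorem costSseq_le_of_logb_le {V : Type*} [Fintype V] {G : SimpleGraph V} {s : V} {b c L : ℝ}
    (hb : 1 < b) (hm : 0 < edgeCount G) (hL : c * Real.logb b (edgeCount G) ≤ L)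
    {e k : ℕ} (he : 1 ≤ e) (hexp : ExpandS G s b 1 e) (hk : k ≤ e)
    (hLk : L ≤ 2 * ((e - k : ℕ) : ℝ) + 2) :
    (costSseq G s 1 k : ℝ) ≤ 2 * (b ^ 2 / (b - 1)) * (edgeCount G : ℝ) ^ (1 - c / 2) := by
  have hm' : (0 : ℝ) < edgeCount G := by exact_mod_cast hm
  have hb1 : 0 < b - 1 := by linarith
  have hsum := costSseq_mul_pow_le hb he hexp hk
  have hpow := rpow_div_two_le_mul_pow hb hm' hL hLk
  rw [Real.rpow_sub hm', Real.rpow_one]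
  have hx : 0 < (edgeCount G : ℝ) ^ (c / 2) := Real.rpow_pos_of_pos hm' _
  rw [mul_div_assoc', mul_div_assoc', div_mul_eq_mul_div, div_div, le_div_iff₀ (by positivity)]
  calc (costSseq G s 1 k : ℝ) * ((b - 1) * (edgeCount G : ℝ) ^ (c / 2))
      ≤ costSseq G s 1 k * ((b - 1) * (b * b ^ (e - k))) := by gcongr
    _ = b * ((b - 1) * costSseq G s 1 k * b ^ (e - k)) := by ring
    _ ≤ b * (2 * b * edgeCount G) := by gcongr
    _ = 2 * b ^ 2 * edgeCount G := by ring

/-- Theorem 4: large absolute expansion overlap.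
For `b > 1`, let `s, t` be a start--destination pair with a `b`-expansion overlap of
size at least `c · log_b(m)` for a constant `c > 0`. Then there is an exploration step
`k ∈ {1, ..., d(s,t)}` with meeting cost
`M(k) = c_s([1,k]) + c_t([k+1, d(s,t)]) ≤ 8 · (b² / (b-1)) · m^{1 - c/2}`. -/
theorem stmt_5 {V : Type*} [Fintype V] (G : SimpleGraph V) (s t : V)
    (hconn : G.Connected) (hst : s ≠ t) (b c : ℝ) (hb : 1 < b) (hc : 0 < c)
    (es et : ℕ) (hes : IsExpanS G s t b es) (het : IsExpanT G s t b et)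
    (hoverlap : et ≤ es)
    (hsize : c * Real.logb b (edgeCount G : ℝ) ≤ (es : ℝ) - et + 1) :
    ∃ k, 1 ≤ k ∧ k ≤ G.dist s t ∧
      (meetCost G s t k : ℝ) ≤
        8 * (b ^ 2 / (b - 1)) * (edgeCount G : ℝ) ^ (1 - c / 2) := by
  obtain ⟨hes1, hesd, hexpS, -⟩ := hes
  obtain ⟨het1, hetd, hexpT, -⟩ := het
  have hm := edgeCount_pos hconn hst
  refine ⟨(es + et) / 2, by omega, by omega, ?_⟩
  have hS := costSseq_le_of_logb_le hb hm hsize hes1 hexpS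
    (k := (es + et) / 2) (by omega) (by
      have : es + 1 ≤ 2 * (es - (es + et) / 2) + 2 + et := by omega
      have : (es : ℝ) + 1 ≤ 2 * ((es - (es + et) / 2 : ℕ) : ℝ) + 2 + et := by exact_mod_cast this
      linarith)
  have hT := costSseq_le_of_logb_le hb hm hsize (Nat.le_add_left 1 _) hexpT.expandS
    (k := G.dist s t - (es + et) / 2) (by omega) (by
      set x := G.dist s t - et + 1 - (G.dist s t - (es + et) / 2) with hx
      have : es + 1 ≤ 2 * x + 2 + et := by omega
      have : (es : ℝ) + 1 ≤ 2 * (x : ℝ) + 2 + et := by exact_mod_cast this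
      linarith)
  rw [meetCost, costTseq_eq_costSseq]
  push_cast
  have hpos : 0 ≤ b ^ 2 / (b - 1) * (edgeCount G : ℝ) ^ (1 - c / 2) :=
    mul_nonneg (div_nonneg (sq_nonneg b) (by linarith)) (by positivity)
  linarith
end

section
/- For all real constants 0 ≤ α < 1, b > 1, b⁺ ≥ b, and ρ₀ with 0 ≤ ρ₀ < (1−α)/(1−α+α·log_b(b⁺)), there exist constants C > 0 and ε > 0 with the following property: for every simple, undirected, connected graph G with m edges and all distinct vertices s,t such that cheap_s(α), cheap_t(α), expan_s(b), expan_t(b) are defined, b⁺ is the highest expansion between s and t, and ρ_{s,t}(α,b) ≤ ρ₀, there exists an exploration step k ∈ {0,...,d(s,t)} with meeting cost M(k) ≤ C·m^{1−ε}. -/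
open Finset

/-- Partial sums of a nonnegative `b`-expanding sequence grow by a factor `b` per step. -/
theorem pow_mul_sum_range_le {f : ℕ → ℝ} {b : ℝ} (hb : 0 ≤ b) (hf : ∀ i, 0 ≤ f i) {x : ℕ}
    (h : ∀ i, i + 1 < x → b * f i ≤ f (i + 1)) (j k : ℕ) (hk : k + j ≤ x) :
    b ^ j * ∑ i ∈ range k, f i ≤ ∑ i ∈ range (k + j), f i := by
  induction j with
  | zero => simp
  | succ j ih =>
    have step : b * ∑ i ∈ range (k + j), f i ≤ ∑ i ∈ range (k + j + 1), f i := by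
      rw [sum_range_succ', mul_sum]
      have : ∑ i ∈ range (k + j), b * f i ≤ ∑ i ∈ range (k + j), f (i + 1) :=
        sum_le_sum fun i hi => h i (by have := mem_range.1 hi; omega)
      linarith [hf 0]
    calc b ^ (j + 1) * ∑ i ∈ range k, f i = b * (b ^ j * ∑ i ∈ range k, f i) := by ring
      _ ≤ b * ∑ i ∈ range (k + j), f i := mul_le_mul_of_nonneg_left (ih (by omega)) hb
      _ ≤ _ := step

/-- Partial sums of a sequence that is at most `B`-expanding grow at most geometrically. -/
theorem sum_range_add_le {g : ℕ → ℝ} {B : ℝ} (hB : 1 < B) (hg : ∀ i, 0 ≤ g i) {d : ℕ}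
    (h : ∀ i, i + 1 < d → g (i + 1) ≤ B * g i) {q : ℕ} (hq : 1 ≤ q) (n : ℕ) (hn : q + n ≤ d) :
    ∑ i ∈ range (q + n), g i ≤ B ^ n * ((1 + 1 / (B - 1)) * ∑ i ∈ range q, g i) := by
  have hB' : 0 < B - 1 := by linarith
  have key : ∑ i ∈ range (q + n), g i + g 0 / (B - 1) ≤
      B ^ n * (∑ i ∈ range q, g i + g 0 / (B - 1)) := by
    induction n with
    | zero => simp
    | succ n ih =>
      have step : ∑ i ∈ range (q + n + 1), g i ≤ B * ∑ i ∈ range (q + n), g i + g 0 := by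
        rw [sum_range_succ', mul_sum]
        have : ∑ i ∈ range (q + n), g (i + 1) ≤ ∑ i ∈ range (q + n), B * g i :=
          sum_le_sum fun i hi => h i (by have := mem_range.1 hi; omega)
        linarith
      have e : g 0 + g 0 / (B - 1) = B * (g 0 / (B - 1)) := by field_simp; ring
      have := mul_le_mul_of_nonneg_left (ih (by omega)) (by linarith : 0 ≤ B)
      rw [← add_assoc, pow_succ']
      nlinarith
  have h0 : g 0 ≤ ∑ i ∈ range q, g i :=
    single_le_sum (fun i _ => hg i) (mem_range.2 (by omega))
  have h1 : 0 ≤ g 0 / (B - 1) := div_nonneg (hg 0) hB'.le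
  have h2 : g 0 / (B - 1) ≤ (∑ i ∈ range q, g i) / (B - 1) := by gcongr
  calc ∑ i ∈ range (q + n), g i ≤ B ^ n * (∑ i ∈ range q, g i + g 0 / (B - 1)) := by linarith
    _ ≤ B ^ n * (∑ i ∈ range q, g i + (∑ i ∈ range q, g i) / (B - 1)) := by gcongr
    _ = _ := by ring

/-- A `b`-expanding sequence starting at `1` or more has at most logarithmically many steps. -/
theorem natCast_le_one_add_logb {g : ℕ → ℝ} {b A : ℝ} (hb : 1 < b) (h0 : 1 ≤ g 0)
    {r : ℕ} (hr : 1 ≤ r) (h : ∀ i, i + 1 < r → b * g i ≤ g (i + 1)) (hA : g (r - 1) ≤ A) :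
    (r : ℝ) ≤ 1 + Real.logb b A := by
  have key : ∀ j, j < r → b ^ j ≤ g j := by
    intro j
    induction j with
    | zero => intro _; simpa using h0
    | succ j ih =>
      intro hj
      have := mul_le_mul_of_nonneg_left (ih (by omega)) (by linarith : 0 ≤ b)
      rw [pow_succ']
      linarith [h j hj]
  have h1 : b ^ (r - 1) ≤ A := (key (r - 1) (by omega)).trans hA
  have h2 : ((r - 1 : ℕ) : ℝ) ≤ Real.logb b A := by
    rw [Real.le_logb_iff_rpow_le hb (lt_of_lt_of_le (by positivity) h1), Real.rpow_natCast]
    exact h1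
  rw [Nat.cast_sub hr] at h2
  push_cast at h2
  linarith

/-- The meeting cost estimate for a forward cost sequence `f` and a backward cost sequence `g`. -/
theorem exists_sublinear_meeting {α b B ρ : ℝ} (hα0 : 0 ≤ α) (hα1 : α < 1) (hb : 1 < b)
    (hB : b ≤ B) (hρ0 : 0 ≤ ρ) (hρ1 : ρ < (1 - α) / (1 - α + α * Real.logb b B)) :
    ∃ C ε : ℝ, 0 < C ∧ 0 < ε ∧ ∀ (f g : ℕ → ℝ) (M : ℝ) (d q x y : ℕ), 1 ≤ M →
      (∀ i, 0 ≤ f i) → (∀ i, 0 ≤ g i) → 1 ≤ g 0 →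
      (∀ n, ∑ i ∈ range n, f i ≤ 2 * M) → (∀ n, ∑ i ∈ range n, g i ≤ 2 * M) →
      x ≤ d → 1 ≤ y → 1 ≤ q → q ≤ d →
      (∀ i, i + 1 < x → b * f i ≤ f (i + 1)) → (∀ i, i + 1 < y → b * g i ≤ g (i + 1)) →
      (∀ i, i + 1 < d → g (i + 1) ≤ B * g i) →
      ∑ i ∈ range q, g i ≤ M ^ α → (d : ℝ) - q - x ≤ ρ * y →
      ∃ k ≤ d, ∑ i ∈ range k, f i + ∑ i ∈ range (d - k), g i ≤ C * M ^ (1 - ε) := by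
  set L := Real.logb b B with hL
  have hb0 : 0 < b := by linarith
  have hB1 : 1 < B := by linarith
  have hL1 : 1 ≤ L := by
    rw [hL, Real.le_logb_iff_rpow_le hb (by linarith)]; simpa using hB
  have hαL : 0 ≤ α * L := by positivity
  have hden : 0 < 1 - α + α * L := by linarith
  rw [lt_div_iff₀ hden] at hρ1
  have hρ : ρ < 1 := by nlinarith
  have hρ' : 0 < 1 - ρ := by linarith
  obtain ⟨η, hη0, hη⟩ : ∃ η : ℝ, 0 < η ∧ η * (3 * L + 1) = (1 - α) * (1 - ρ) - L * ρ * α :=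
    ⟨((1 - α) * (1 - ρ) - L * ρ * α) / (3 * L + 1), div_pos (by linarith) (by linarith),
      by field_simp⟩
  have hcoef : L * (ρ * (α + 2 * η) / (1 - ρ) + η) ≤ 1 - α - η := by
    have : ρ * (α + 2 * η) / (1 - ρ) + η =
      (ρ * (α + 2 * η) + η * (1 - ρ)) / (1 - ρ) := by field_simp
    rw [this, ← mul_div_assoc, div_le_iff₀ hρ']
    have h1 : 0 ≤ η * L * (1 - ρ) := by positivity
    have h2 : 0 ≤ η * ρ := by positivity
    nlinarith
  set c := L * (3 * ρ / (1 - ρ) + 1) with hc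
  have hK : 0 < 1 + 1 / (B - 1) := by
    have : 0 < B - 1 := by linarith
    positivity
  refine ⟨4 + b ^ c * (1 + 1 / (B - 1)), η, by positivity, hη0, ?_⟩
  intro f g M d q x y hM hf hg hg0 hfM hgM hxd hy hq hqd hfx hgy hgB hgq hS
  have hM0 : 0 < M := by linarith
  set l := Real.logb b M with hl
  have hl0 : 0 ≤ l := Real.logb_nonneg hb hM
  have hbl : b ^ l = M := Real.rpow_logb hb0 hb.ne' hM0
  have hpowM : ∀ e : ℝ, M ^ e = b ^ (l * e) := fun e => by
    rw [Real.rpow_mul hb0.le, hbl]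
  set J := ⌈η * l⌉₊ with hJ
  have hJ1 : η * l ≤ J := Nat.le_ceil _
  have hJ2 : (J : ℝ) < η * l + 1 := Nat.ceil_lt_add_one (by positivity)
  have hMη : 0 < M ^ (1 - η) := by positivity
  have hsmall : ∀ S : ℝ, b ^ J * S ≤ 2 * M → S ≤ 2 * M ^ (1 - η) := by
    intro S hS
    by_cases hS0 : 0 ≤ S
    · have h1 : M ^ η ≤ b ^ J := by
        rw [hpowM, ← Real.rpow_natCast]
        exact Real.rpow_le_rpow_of_exponent_le hb.le (by linarith)
      have h2 : M ^ η * S ≤ 2 * M := (mul_le_mul_of_nonneg_right h1 hS0).trans hS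
      have h3 : 0 < M ^ η := by positivity
      rw [Real.rpow_sub hM0, Real.rpow_one, ← mul_div_assoc, le_div_iff₀ h3]
      linarith
    · linarith
  refine ⟨x - J, by omega, ?_⟩
  have hforward : ∑ i ∈ range (x - J), f i ≤ 2 * M ^ (1 - η) := by
    by_cases hxJ : x ≤ J
    · rw [Nat.sub_eq_zero_of_le hxJ]; simp; positivity
    · exact hsmall _ ((pow_mul_sum_range_le hb0.le hf hfx J (x - J) (by omega)).trans (hfM _))
  have hbackward : ∑ i ∈ range (d - (x - J)), g i ≤
      (2 + b ^ c * (1 + 1 / (B - 1))) * M ^ (1 - η) := by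
    by_cases hcase : d - (x - J) + J ≤ y
    · have := hsmall _ ((pow_mul_sum_range_le hb0.le hg hgy J _ hcase).trans (hgM _))
      have : 0 ≤ b ^ c * (1 + 1 / (B - 1)) * M ^ (1 - η) := by positivity
      linarith
    · have hlogα : Real.logb b (M ^ α) = α * l := Real.logb_rpow_eq_mul_logb_of_pos hM0
      have hr : ((min q y : ℕ) : ℝ) ≤ 1 + α * l := by
        rw [← hlogα]
        refine natCast_le_one_add_logb hb hg0 (le_min hq hy) (fun i hi => hgy i (by omega)) ?_
        exact (single_le_sum (fun i _ => hg i) (mem_range.2 (by omega))).trans hgq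
      have hηl : 0 ≤ η * l := by positivity
      have hy' : (1 - ρ) * y ≤ 3 + (α + 2 * η) * l := by
        rcases le_total q y with h | h
        · rw [min_eq_left h] at hr
          have h1 : y + x ≤ d + 2 * J := by omega
          have h2 : (y : ℝ) + x ≤ d + 2 * J := by exact_mod_cast h1
          linarith
        · rw [min_eq_right h] at hr
          have : 0 ≤ ρ * y := by positivity
          linarith
      set n := d - (x - J) - q with hn
      have hS2 : ρ * y ≤ ρ * (3 + (α + 2 * η) * l) / (1 - ρ) := by
        rw [le_div_iff₀ hρ']
        nlinarith
      have hnle : (n : ℝ) ≤ ρ * (3 + (α + 2 * η) * l) / (1 - ρ) + η * l + 1 := by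
        by_cases hn0 : n = 0
        · rw [hn0]; push_cast; positivity
        · have h1 : n + q + x ≤ d + J := by omega
          have h2 : (n : ℝ) + q + x ≤ d + J := by exact_mod_cast h1
          linarith
      have hexp : L * n + l * α ≤ c + l * (1 - η) := by
        have h1 := mul_le_mul_of_nonneg_left hnle (by linarith : 0 ≤ L)
        have h2 : L * (ρ * (3 + (α + 2 * η) * l) / (1 - ρ) + η * l + 1) =
            c + l * (L * (ρ * (α + 2 * η) / (1 - ρ) + η)) := by
          rw [hc]; ring
        have h3 := mul_le_mul_of_nonneg_left hcoef hl0
        linarith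
      have hBn : B ^ n = b ^ (L * n) := by
        rw [Real.rpow_mul hb0.le, hL, Real.rpow_logb hb0 hb.ne' (by linarith),
          Real.rpow_natCast]
      calc ∑ i ∈ range (d - (x - J)), g i ≤ ∑ i ∈ range (q + n), g i :=
            sum_le_sum_of_subset_of_nonneg (range_mono (by omega)) fun i _ _ => hg i
        _ ≤ B ^ n * ((1 + 1 / (B - 1)) * ∑ i ∈ range q, g i) :=
            sum_range_add_le hB1 hg hgB hq n (by omega)
        _ ≤ B ^ n * ((1 + 1 / (B - 1)) * M ^ α) := by gcongr
        _ = (1 + 1 / (B - 1)) * b ^ (L * n + l * α) := by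
            rw [hBn, hpowM, Real.rpow_add hb0]; ring
        _ ≤ (1 + 1 / (B - 1)) * b ^ (c + l * (1 - η)) := by
            gcongr
            exact hb.le
        _ = b ^ c * (1 + 1 / (B - 1)) * M ^ (1 - η) := by
            rw [hpowM, Real.rpow_add hb0]; ring
        _ ≤ _ := by
            rw [add_mul]
            linarith
  linarith

section Layers

variable {V : Type*} [Fintype V] (G : SimpleGraph V)

theorem sum_deg_eq : ∑ u, deg G u = 2 * edgeCount G := by
  classical
  have h := G.sum_degrees_eq_twice_card_edges
  have h1 : ∀ u, deg G u = G.degree u := fun u => by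
    rw [deg, Nat.card_eq_fintype_card, SimpleGraph.card_neighborSet_eq_degree]
  have h2 : edgeCount G = G.edgeFinset.card := by
    rw [edgeCount, Nat.card_eq_fintype_card, SimpleGraph.edgeFinset_card]
  simp only [h1, h2, h]

theorem sum_layers_le (v : V) (n : ℕ) :
    ∑ i ∈ range n, ∑ u ∈ layer G v i, deg G u ≤ 2 * edgeCount G := by
  classical
  rw [← sum_deg_eq, ← sum_biUnion]
  · exact sum_le_sum_of_subset (subset_univ _)
  · intro i _ j _ hij
    refine disjoint_left.2 fun u hi hj => hij ?_
    simp only [layer, mem_filter, mem_univ, true_and] at hi hj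
    exact hi.symm.trans hj

variable {G}

theorem one_le_deg (hG : G.Connected) {s t : V} (hst : s ≠ t) : 1 ≤ deg G t := by
  have : Nontrivial V := ⟨s, t, hst⟩
  obtain ⟨u, hu⟩ := hG.preconnected.exists_adj_of_nontrivial t
  have : Nonempty (G.neighborSet t) := ⟨⟨u, hu⟩⟩
  exact Nat.card_pos

theorem one_le_edgeCount (hG : G.Connected) {s t : V} (hst : s ≠ t) : 1 ≤ edgeCount G := by
  have : Nontrivial V := ⟨s, t, hst⟩
  obtain ⟨u, hu⟩ := hG.preconnected.exists_adj_of_nontrivial t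
  have : Nonempty G.edgeSet := ⟨⟨s(t, u), hu⟩⟩
  exact Nat.card_pos

variable (G)

theorem costSseq_eq (s : V) (k : ℕ) :
    costSseq G s 1 k = ∑ i ∈ range k, ∑ u ∈ layer G s i, deg G u := by
  rw [costSseq, ← Ico_succ_right_eq_Icc, Nat.succ_eq_succ, sum_Ico_eq_sum_range]
  refine sum_congr (by simp) fun i _ => ?_
  rw [costS, Nat.add_sub_cancel_left]

theorem costTseq_eq (s t : V) {k : ℕ} (hk : k ≤ G.dist s t) :
    costTseq G s t (k + 1) (G.dist s t) =
      ∑ i ∈ range (G.dist s t - k), ∑ u ∈ layer G t i, deg G u := by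
  rw [costTseq]
  refine sum_nbij' (fun j => G.dist s t - j) (fun i => G.dist s t - i) ?_ ?_ ?_ ?_ ?_
  · intro j hj; simp only [mem_Icc, mem_range] at *; omega
  · intro j hj; simp only [mem_Icc, mem_range] at *; omega
  · intro j hj; simp only [mem_Icc] at *; omega
  · intro j hj; simp only [mem_range] at *; omega
  · intro j _; rfl

end Layers

/-- Lemma 10: sublinear meeting cost for small `ρ`.
For all constants `0 ≤ α < 1`, `b > 1`, `b⁺ ≥ b`, `0 ≤ ρ₀ < (1-α)/(1-α+α·log_b(b⁺))`
there are constants `C > 0` and `ε > 0` such that: whenever `cheap_s(α)`, `cheap_t(α)`,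
`expan_s(b)`, `expan_t(b)` are defined, `b⁺` is the highest expansion between `s` and `t`,
and `ρ_{s,t}(α,b) ≤ ρ₀`, some exploration step `k ∈ {0, ..., d(s,t)}` has meeting cost
`M(k) ≤ C · m^{1-ε}`. -/
theorem stmt_11 (α b bp ρ₀ : ℝ) (hα0 : 0 ≤ α) (hα1 : α < 1) (hb : 1 < b)
    (hbp : b ≤ bp) (hρ0 : 0 ≤ ρ₀)
    (hρ1 : ρ₀ < (1 - α) / (1 - α + α * Real.logb b bp)) :
    ∃ C ε : ℝ, 0 < C ∧ 0 < ε ∧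
      ∀ (V : Type) [Fintype V] (G : SimpleGraph V) (s t : V),
        G.Connected → s ≠ t →
        ∀ cs ct es et : ℕ, IsCheapS G s t α cs → IsCheapT G s t α ct →
          IsExpanS G s t b es → IsExpanT G s t b et →
          IsHighestExpansion G s t bp →
          rho (G.dist s t) cs ct es et ≤ ρ₀ →
          ∃ k ≤ G.dist s t,
            (meetCost G s t k : ℝ) ≤ C * (edgeCount G : ℝ) ^ (1 - ε) := by
  obtain ⟨C, ε, hC, hε, H⟩ := exists_sublinear_meeting hα0 hα1 hb hbp hρ0 hρ1
  refine ⟨C, ε, hC, hε, ?_⟩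
  intro V _ G s t hG hst cs ct es et _ hct hes het hB hrho
  obtain ⟨hct1, hctd, hctc, -⟩ := hct
  obtain ⟨hes1, hesd, hese, -⟩ := hes
  obtain ⟨het1, hetd, hete, -⟩ := het
  set d := G.dist s t with hd
  have hg0 : 1 ≤ ∑ u ∈ layer G t 0, deg G u :=
    (one_le_deg hG hst).trans
      (single_le_sum (f := deg G) (fun _ _ => Nat.zero_le _) (by simp [layer]))
  obtain ⟨k, hk, hle⟩ := H
    (fun i => ((∑ u ∈ layer G s i, deg G u : ℕ) : ℝ))
    (fun i => ((∑ u ∈ layer G t i, deg G u : ℕ) : ℝ))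
    (edgeCount G) d (d - ct + 1) es (d - et + 1)
    (by exact_mod_cast one_le_edgeCount hG hst)
    (fun _ => Nat.cast_nonneg _) (fun _ => Nat.cast_nonneg _)
    (by exact_mod_cast hg0)
    (fun n => by exact_mod_cast sum_layers_le G s n)
    (fun n => by exact_mod_cast sum_layers_le G t n)
    hesd (by omega) (by omega) (by omega)
    (fun i hi => by simpa [costS] using hese (i + 1) (by omega) hi)
    (fun i hi => by
      have h := hete (d - i) (by omega) (by omega)
      simp only [costT, ← hd] at h
      rwa [show d - (d - i) = i by omega, show d - (d - i - 1) = i + 1 by omega] at h)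
    (fun i hi => by
      have h := hB.1.2 (d - i) (by omega) (by omega)
      simp only [costT, ← hd] at h
      rwa [show d - (d - i) = i by omega, show d - (d - i - 1) = i + 1 by omega] at h)
    (by
      have h := costTseq_eq G s t (k := ct - 1) (by omega)
      rw [← hd, Nat.sub_add_cancel hct1, show d - (ct - 1) = d - ct + 1 by omega] at h
      rw [h] at hctc
      exact_mod_cast hctc)
    (by
      have hes' : (1 : ℝ) ≤ es := by exact_mod_cast hes1
      have het' : (et : ℝ) ≤ d := by exact_mod_cast hetd
      rw [rho, div_le_iff₀ (lt_min (by linarith) (by linarith))] at hrho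
      push_cast [Nat.cast_sub hctd, Nat.cast_sub hetd]
      have h1 := (le_max_left _ _).trans hrho
      have h2 := mul_le_mul_of_nonneg_left (min_le_right (es : ℝ) ((d : ℝ) - et + 1)) hρ0
      linarith)
  refine ⟨k, hk, ?_⟩
  rw [meetCost, costSseq_eq, costTseq_eq G s t hk]
  exact_mod_cast hle
end
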